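/- Let φ be a proper edge-coloring of the complete graph K_{2m} and let T be a rainbow spanning tree of K_{2m} containing a vertex r and two distinct leaves y and v both adjacent to r. Let w and v′ be vertices with w ≠ y and v′ ≠ v such that φ(ry) = φ(vv′) and φ(rv) = φ(yw). Then T′ = T − ry − rv + yw + vv′ is a rainbow spanning tree of K_{2m}. -/

import Mathlib

/-- A proper edge-coloring of the complete graph on `Fin n`: any two distinct
edges sharing a vertex receive distinct colors. -/
def ProperEdgeColoring {n : ℕ} {C : Type*} (φ : Sym2 (Fin n) → C) : Prop :=
  ∀ a b₁ b₂ : Fin n, a ≠ b₁ → a ≠ b₂ → b₁ ≠ b₂ → φ s(a, b₁) ≠ φ s(a, b₂)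

/-- The graph `T[r; y, v; w, v'] = T - ry - rv + yw + vv'`, obtained from `T` by
removing the edges `ry` and `rv` and adding the edges `yw` and `vv'`. -/
def swapTree {n : ℕ} (T : SimpleGraph (Fin n)) (r y v w v' : Fin n) :
    SimpleGraph (Fin n) :=
  (T.deleteEdges {s(r, y), s(r, v)}) ⊔ SimpleGraph.fromEdgeSet {s(y, w), s(v, v')}

theorem mem_edgeSet_swapTree {n : ℕ} {T : SimpleGraph (Fin n)} {r y v w v' : Fin n}
    (hwy : w ≠ y) (hv'v : v' ≠ v) {e : Sym2 (Fin n)} :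
    e ∈ (swapTree T r y v w v').edgeSet ↔
      (e ∈ T.edgeSet ∧ e ≠ s(r, y) ∧ e ≠ s(r, v)) ∨ e = s(y, w) ∨ e = s(v, v') := by
  have h1 : s(y, w) ∉ Sym2.diagSet := by simpa using hwy.symm
  have h2 : s(v, v') ∉ Sym2.diagSet := by simpa using hv'v.symm
  simp only [swapTree, SimpleGraph.edgeSet_sup, SimpleGraph.edgeSet_deleteEdges,
    SimpleGraph.edgeSet_fromEdgeSet, Set.mem_union, Set.mem_sdiff, Set.mem_insert_iff,
    Set.mem_singleton_iff]
  grind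

theorem eq_of_adj_of_ncard_neighborSet_eq_one {V : Type*} {G : SimpleGraph V} {y r x : V}
    (hy : (G.neighborSet y).ncard = 1) (hr : G.Adj y r) (hx : G.Adj y x) : x = r := by
  obtain ⟨a, ha⟩ := Set.ncard_eq_one.mp hy
  have h1 : r ∈ G.neighborSet y := hr
  have h2 : x ∈ G.neighborSet y := hx
  rw [ha] at h1 h2
  exact h2.trans h1.symm

/-- Moving two leaves `y, v` from their neighbor `r` to vertices `w, v'` other than
`y, v` keeps a graph connected. -/
theorem connected_swapTree {n : ℕ} {T : SimpleGraph (Fin n)} {r y v w v' : Fin n}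
    (hT : T.Connected) (hry : T.Adj r y) (hrv : T.Adj r v)
    (hyleaf : (T.neighborSet y).ncard = 1) (hvleaf : (T.neighborSet v).ncard = 1)
    (hwy : w ≠ y) (hwv : w ≠ v) (hv'y : v' ≠ y) (hv'v : v' ≠ v) :
    (swapTree T r y v w v').Connected := by
  set G := swapTree T r y v w v'
  have hyr : ∀ x, T.Adj y x → x = r := fun x =>
    eq_of_adj_of_ncard_neighborSet_eq_one hyleaf hry.symm
  have hvr : ∀ x, T.Adj v x → x = r := fun x =>
    eq_of_adj_of_ncard_neighborSet_eq_one hvleaf hrv.symm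
  have hadj : ∀ a b, T.Adj a b → a ≠ y → a ≠ v → b ≠ y → b ≠ v → G.Adj a b := by
    intro a b hab h1 h2 h3 h4
    rw [← SimpleGraph.mem_edgeSet, mem_edgeSet_swapTree hwy hv'v]
    refine Or.inl ⟨hab, ?_, ?_⟩ <;> simp [*]
  have hyw : G.Adj y w := by
    rw [← SimpleGraph.mem_edgeSet, mem_edgeSet_swapTree hwy hv'v]
    exact Or.inr (Or.inl rfl)
  have hvv' : G.Adj v v' := by
    rw [← SimpleGraph.mem_edgeSet, mem_edgeSet_swapTree hwy hv'v]
    exact Or.inr (Or.inr rfl)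
  let f : Fin n → Fin n := fun x => if x = y ∨ x = v then r else x
  have hf : ∀ x, x ≠ y → x ≠ v → f x = x := fun x h1 h2 => if_neg (by tauto)
  have hfy : f y = r := if_pos (Or.inl rfl)
  have hfv : f v = r := if_pos (Or.inr rfl)
  have hfr : f r = r := hf r hry.ne hrv.ne
  have hstep : ∀ a b, T.Adj a b → G.Reachable (f a) (f b) := by
    intro a b hab
    by_cases h1 : a = y
    · subst h1; rw [hyr b hab, hfy, hfr]
    by_cases h2 : a = v
    · subst h2; rw [hvr b hab, hfv, hfr]
    by_cases h3 : b = y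
    · subst h3; rw [hyr a hab.symm, hfy, hfr]
    by_cases h4 : b = v
    · subst h4; rw [hvr a hab.symm, hfv, hfr]
    rw [hf a h1 h2, hf b h3 h4]
    exact (hadj a b hab h1 h2 h3 h4).reachable
  have hwalk : ∀ a b, T.Walk a b → G.Reachable (f a) (f b) := by
    intro a b p
    induction p with
    | nil => exact SimpleGraph.Reachable.refl _
    | cons h _ ih => exact (hstep _ _ h).trans ih
  have hroot : ∀ x, x ≠ y → x ≠ v → G.Reachable x r := by
    intro x h1 h2
    obtain ⟨p⟩ := hT.preconnected x r
    simpa only [hf x h1 h2, hfr] using hwalk x r p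
  have hall : ∀ x, G.Reachable x r := by
    intro x
    by_cases h1 : x = y
    · subst h1; exact hyw.reachable.trans (hroot w hwy hwv)
    by_cases h2 : x = v
    · subst h2; exact hvv'.reachable.trans (hroot v' hv'y hv'v)
    exact hroot x h1 h2
  have : Nonempty (Fin n) := ⟨r⟩
  exact ⟨fun a b => (hall a).trans (hall b).symm⟩

theorem injOn_edgeSet_swapTree {n : ℕ} {C : Type*} {φ : Sym2 (Fin n) → C}
    {T : SimpleGraph (Fin n)} {r y v w v' : Fin n} (hrainbow : Set.InjOn φ T.edgeSet)
    (hyv : y ≠ v) (hry : T.Adj r y) (hrv : T.Adj r v) (hwy : w ≠ y) (hv'v : v' ≠ v)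
    (hc1 : φ s(r, y) = φ s(v, v')) (hc2 : φ s(r, v) = φ s(y, w)) :
    Set.InjOn φ (swapTree T r y v w v').edgeSet := by
  have h1 : s(r, y) ∈ T.edgeSet := hry
  have h2 : s(r, v) ∈ T.edgeSet := hrv
  have hne : s(r, y) ≠ s(r, v) := fun h => hyv (Sym2.congr_right.mp h)
  have hne' : φ s(r, y) ≠ φ s(r, v) := fun h => hne (hrainbow h1 h2 h)
  intro e he e' he' h
  rw [mem_edgeSet_swapTree hwy hv'v] at he he'
  rcases he with ⟨he, hey, hev⟩ | rfl | rfl <;> rcases he' with ⟨he', hey', hev'⟩ | rfl | rfl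
  · exact hrainbow he he' h
  · exact absurd (hrainbow he h2 (h.trans hc2.symm)) hev
  · exact absurd (hrainbow he h1 (h.trans hc1.symm)) hey
  · exact absurd (hrainbow h2 he' (hc2.trans h)).symm hev'
  · rfl
  · exact absurd (hc1.trans (h.symm.trans hc2.symm)) hne'
  · exact absurd (hrainbow h1 he' (hc1.trans h)).symm hey'
  · exact absurd (hc1.trans (h.trans hc2.symm)) hne'
  · rfl

theorem ncard_edgeSet_swapTree_le {n : ℕ} {T : SimpleGraph (Fin n)} {r y v w v' : Fin n}
    (hyv : y ≠ v) (hry : T.Adj r y) (hrv : T.Adj r v) (hwy : w ≠ y) (hv'v : v' ≠ v) :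
    (swapTree T r y v w v').edgeSet.ncard ≤ T.edgeSet.ncard := by
  have hne : s(r, y) ≠ s(r, v) := fun h => hyv (Sym2.congr_right.mp h)
  have hsub : {s(r, y), s(r, v)} ⊆ T.edgeSet :=
    Set.insert_subset hry (Set.singleton_subset_iff.mpr hrv)
  have heq : (swapTree T r y v w v').edgeSet =
      (T.edgeSet \ {s(r, y), s(r, v)}) ∪ {s(y, w), s(v, v')} := by
    ext e
    simp only [mem_edgeSet_swapTree hwy hv'v, Set.mem_union, Set.mem_sdiff,
      Set.mem_insert_iff, Set.mem_singleton_iff, not_or, ne_eq]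
  have h1 := Set.ncard_sdiff_add_ncard_of_subset hsub
  rw [Set.ncard_pair hne] at h1
  have h2 := Set.ncard_union_le (T.edgeSet \ {s(r, y), s(r, v)}) {s(y, w), s(v, v')}
  have h3 := Set.ncard_insert_le s(y, w) {s(v, v')}
  rw [Set.ncard_singleton] at h3
  rw [heq]
  omega


/-- Let `φ` be a proper edge-coloring of `K_{2m}` and `T` a
rainbow spanning tree of `K_{2m}` with a vertex `r` and two distinct leaves `y, v`
adjacent to `r`.  If `w ≠ y`, `v' ≠ v`, `φ(ry) = φ(vv')` and `φ(rv) = φ(yw)`,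
then `T' = T - ry - rv + yw + vv'` is a rainbow spanning tree of `K_{2m}`. -/
theorem statement4 (m : ℕ) {C : Type*} (φ : Sym2 (Fin (2 * m)) → C)
    (hφ : ProperEdgeColoring φ)
    (T : SimpleGraph (Fin (2 * m))) (hT : T.IsTree)
    (hrainbow : Set.InjOn φ T.edgeSet)
    (r y v w v' : Fin (2 * m))
    (hyv : y ≠ v) (hry : T.Adj r y) (hrv : T.Adj r v)
    (hyleaf : (T.neighborSet y).ncard = 1) (hvleaf : (T.neighborSet v).ncard = 1)
    (hwy : w ≠ y) (hv'v : v' ≠ v)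
    (hc1 : φ s(r, y) = φ s(v, v')) (hc2 : φ s(r, v) = φ s(y, w)) :
    (swapTree T r y v w v').IsTree ∧ Set.InjOn φ (swapTree T r y v w v').edgeSet := by
  have hwv : w ≠ v := by
    rintro rfl
    refine hφ w r y hrv.ne' hyv.symm hry.ne ?_
    rwa [Sym2.eq_swap, Sym2.eq_swap (a := w)]
  have hv'y : v' ≠ y := by
    rintro rfl
    refine hφ v' r v hry.ne' hyv hrv.ne ?_
    rwa [Sym2.eq_swap, Sym2.eq_swap (a := v')]
  have hconn := connected_swapTree hT.connected hry hrv hyleaf hvleaf hwy hwv hv'y hv'v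
  refine ⟨?_, injOn_edgeSet_swapTree hrainbow hyv hry hrv hwy hv'v hc1 hc2⟩
  have hle := ncard_edgeSet_swapTree_le hyv hry hrv hwy hv'v (w := w) (v' := v')
  have hcard := (SimpleGraph.isTree_iff_connected_and_card.mp hT).2
  have hge := hconn.card_vert_le_card_edgeSet_add_one
  refine SimpleGraph.isTree_iff_connected_and_card.mpr ⟨hconn, ?_⟩
  rw [Nat.card_coe_set_eq] at hcard hge ⊢
  omega
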